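/- For every integer k ≥ 1, c_{k,0} = B_{k+1}/(k(k+1)). -/

import Mathlib

open Finset

/-- `q : ℕ → ℕ → ℤ` satisfies the defining recursion. -/
def IsQ (q : ℕ → ℕ → ℤ) : Prop :=
  q 0 0 = 1 ∧
  (∀ k j, k < j → q k j = 0) ∧
  (∀ k j, 1 ≤ k → j ≤ k →
    q k j = (2 * (k : ℤ) + 4 * (j : ℤ) - 2) * (if j = 0 then 0 else q (k - 1) (j - 1))
      + ((j : ℤ) + 1) * q (k - 1) j
      + ∑ m ∈ Finset.range k, ∑ l ∈ Finset.range j, q m l * q (k - 1 - m) (j - 1 - l))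

/-- `c : ℕ → ℕ → ℚ` satisfies the defining relations: `c k j = 0` for `j > k`, and
`q k j = (2k+4j)·c k j + (j+1)·c k (j+1)` for all `k ≥ 1` and `0 ≤ j ≤ k`. -/
def IsC (q : ℕ → ℕ → ℤ) (c : ℕ → ℕ → ℚ) : Prop :=
  (∀ k j, k < j → c k j = 0) ∧
  (∀ k j, 1 ≤ k → j ≤ k →
    (q k j : ℚ) = (2 * (k : ℚ) + 4 * (j : ℚ)) * c k j + ((j : ℚ) + 1) * c k (j + 1))


namespace St9

open Polynomial in
/-- row polynomial of a triangular array -/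
noncomputable def rowPoly (c : ℕ → ℕ → ℚ) (k : ℕ) : ℚ[X] :=
  ∑ j ∈ Finset.range (k + 1), Polynomial.C (c k j) * Polynomial.X ^ j

lemma coeff_rowPoly (c : ℕ → ℕ → ℚ) (hc : ∀ k j, k < j → c k j = 0) (k n : ℕ) :
    (rowPoly c k).coeff n = c k n := by
  unfold rowPoly
  simp only [Polynomial.finsetSum_coeff, Polynomial.coeff_C_mul_X_pow]
  rw [Finset.sum_ite_eq]
  split_ifs with h
  · rfl
  · rw [hc]
    simpa [Nat.lt_succ_iff] using h

open Polynomial in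
lemma rowC (q c : ℕ → ℕ → ℚ) (hq : ∀ k j, k < j → q k j = 0) (hc : ∀ k j, k < j → c k j = 0)
    (h : ∀ k j, 1 ≤ k → j ≤ k →
      q k j = (2 * (k : ℚ) + 4 * (j : ℚ)) * c k j + ((j : ℚ) + 1) * c k (j + 1))
    (k : ℕ) (hk : 1 ≤ k) :
    rowPoly q k = 2 * (k : ℚ[X]) * rowPoly c k + (4 * X + 1) * derivative (rowPoly c k) := by
  have e : 2 * (k : ℚ[X]) * rowPoly c k + (4 * X + 1) * derivative (rowPoly c k)
     = C (2 * (k : ℚ)) * rowPoly c k + C 4 * (X * derivative (rowPoly c k))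
        + derivative (rowPoly c k) := by
    have e2 : (C 2 : ℚ[X]) = 2 := map_ofNat C 2
    have e4 : (C 4 : ℚ[X]) = 4 := map_ofNat C 4
    rw [C_mul, e2, e4, C_eq_natCast]; ring
  rw [e]
  ext n
  simp only [coeff_add, coeff_C_mul]
  have h2 : (X * derivative (rowPoly c k)).coeff n = n * c k n := by
    cases n with
    | zero => simp
    | succ n => rw [coeff_X_mul, coeff_derivative, coeff_rowPoly c hc]; push_cast; ring
  rw [h2, coeff_derivative, coeff_rowPoly c hc, coeff_rowPoly c hc, coeff_rowPoly q hq]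
  by_cases hn : n ≤ k
  · rw [h k n hk hn]; ring
  · rw [hq _ _ (by omega), hc _ _ (by omega), hc _ _ (by omega)]; ring

open Polynomial in
lemma rowQ (q : ℕ → ℕ → ℚ) (hq : ∀ k j, k < j → q k j = 0)
    (h : ∀ k j, 1 ≤ k → j ≤ k →
    q k j = (2 * (k : ℚ) + 4 * (j : ℚ) - 2) * (if j = 0 then 0 else q (k - 1) (j - 1))
      + ((j : ℚ) + 1) * q (k - 1) j
      + ∑ m ∈ Finset.range k, ∑ l ∈ Finset.range j, q m l * q (k - 1 - m) (j - 1 - l))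
    (k : ℕ) :
    rowPoly q (k + 1) = X * ((4 * X + 1) * derivative (rowPoly q k) + 2 * (k : ℚ[X]) * rowPoly q k)
      + (4 * X + 1) * rowPoly q k
      + X * ∑ m ∈ Finset.range (k + 1), rowPoly q m * rowPoly q (k - m) := by
  have e : X * ((4 * X + 1) * derivative (rowPoly q k) + 2 * (k : ℚ[X]) * rowPoly q k)
      + (4 * X + 1) * rowPoly q k
      + X * ∑ m ∈ Finset.range (k + 1), rowPoly q m * rowPoly q (k - m)
     = rowPoly q k + X * (C 4 * (X * derivative (rowPoly q k)) + derivative (rowPoly q k)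
        + C (2 * (k : ℚ)) * rowPoly q k + C 4 * rowPoly q k
        + ∑ m ∈ Finset.range (k + 1), rowPoly q m * rowPoly q (k - m)) := by
    have e2 : (C 2 : ℚ[X]) = 2 := map_ofNat C 2
    have e4 : (C 4 : ℚ[X]) = 4 := map_ofNat C 4
    rw [C_mul, e2, e4, C_eq_natCast]; ring
  rw [e]
  have h2 : ∀ n, (X * derivative (rowPoly q k)).coeff n = n * q k n := by
    intro n
    cases n with
    | zero => simp
    | succ n => rw [coeff_X_mul, coeff_derivative, coeff_rowPoly q hq]; push_cast; ring
  ext n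
  cases n with
  | zero =>
    have := h (k + 1) 0 (by omega) (by omega)
    simp at this
    simp [coeff_rowPoly q hq, this]
  | succ n =>
    simp only [coeff_add, coeff_C_mul, coeff_X_mul, h2, coeff_derivative, coeff_rowPoly q hq,
      finsetSum_coeff]
    simp only [coeff_mul, coeff_rowPoly q hq]
    have h3 : ∀ m, ∑ x ∈ Finset.HasAntidiagonal.antidiagonal n, q m x.1 * q (k - m) x.2
        = ∑ l ∈ Finset.range (n + 1), q m l * q (k - m) (n - l) := fun m =>
      Finset.Nat.sum_antidiagonal_eq_sum_range_succ (fun i j => q m i * q (k - m) j) n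
    simp only [h3]
    by_cases hn : n ≤ k
    · rw [h (k + 1) (n + 1) (by omega) (by omega)]
      simp only [Nat.add_sub_cancel, Nat.add_eq_zero_iff, one_ne_zero, and_false, if_false]
      push_cast
      ring
    · have h4 : ∑ m ∈ Finset.range (k + 1), ∑ l ∈ Finset.range (n + 1),
          q m l * q (k - m) (n - l) = 0 := by
        refine Finset.sum_eq_zero fun m hm => Finset.sum_eq_zero fun l hl => ?_
        simp only [Finset.mem_range] at hm hl
        by_cases hl2 : m < l
        · rw [hq _ _ hl2, zero_mul]
        · rw [hq (k - m) (n - l) (by omega), mul_zero]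
      rw [h4, hq _ _ (by omega), hq _ _ (by omega), hq _ _ (by omega)]; ring

section generic

variable {A : Type*} [CommRing A] [Algebra ℚ A] (D : Derivation ℚ A A)

/-- truncated value of the generating function -/
noncomputable def val (c : ℕ → ℕ → ℚ) (s : Finset ℕ) (x t : A) : A :=
  ∑ k ∈ s, Polynomial.aeval x (rowPoly c k) * t ^ k

lemma D_aeval (x : A) (P : Polynomial ℚ) :
    D (Polynomial.aeval x P) = Polynomial.aeval x (Polynomial.derivative P) * D x := by
  rw [Derivation.map_aeval, smul_eq_mul]

lemma D_term (x t g : A) (hx : 2 * D x = (4 * x + 1) * g) (ht : D t = t * g)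
    (P : Polynomial ℚ) (k : ℕ) :
    2 * D (Polynomial.aeval x P * t ^ k) = g * Polynomial.aeval x (2 * (k : Polynomial ℚ) * P
      + (4 * Polynomial.X + 1) * Polynomial.derivative P) * t ^ k := by
  rw [Derivation.leibniz, Derivation.leibniz_pow, D_aeval, ht]
  simp only [smul_eq_mul, nsmul_eq_mul, map_add, map_mul, map_natCast, map_ofNat, map_one,
    Polynomial.aeval_X]
  cases k with
  | zero => 
    simp
    linear_combination (Polynomial.aeval x (Polynomial.derivative P)) * hx
  | succ k =>
    simp only [Nat.add_sub_cancel]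
    linear_combination (t ^ (k + 1) * Polynomial.aeval x (Polynomial.derivative P)) * hx

lemma D_val (q c : ℕ → ℕ → ℚ)
    (h : ∀ k, 1 ≤ k → rowPoly q k = 2 * (k : Polynomial ℚ) * rowPoly c k
      + (4 * Polynomial.X + 1) * Polynomial.derivative (rowPoly c k))
    (h0 : rowPoly q 0 = 1)
    (N : ℕ) (x t g : A) (hx : 2 * D x = (4 * x + 1) * g) (ht : D t = t * g) :
    2 * D (val c (Finset.Icc 1 N) x t) = g * (val q (Finset.range (N + 1)) x t - 1) := by
  have e : val q (Finset.range (N + 1)) x t - 1 = val q (Finset.Icc 1 N) x t := by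
    unfold val
    rw [Finset.range_eq_Ico, Finset.sum_eq_sum_Ico_succ_bot (by omega)]
    rw [h0]
    simp
    rfl
  rw [e]
  unfold val
  rw [map_sum, Finset.mul_sum, Finset.mul_sum]
  refine Finset.sum_congr rfl fun k hk => ?_
  rw [D_term D x t g hx ht, h k (Finset.mem_Icc.1 hk).1]
  ring

lemma sq_trunc (f : ℕ → A) (N : ℕ) (t : A) :
    t ^ (N + 1) ∣ (∑ k ∈ Finset.range (N + 1), f k * t ^ k) ^ 2
      - ∑ n ∈ Finset.range (N + 1), (∑ m ∈ Finset.range (n + 1), f m * f (n - m)) * t ^ n := by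
  let p : Polynomial A := ∑ k ∈ Finset.range (N + 1), Polynomial.C (f k) * Polynomial.X ^ k
  let r : Polynomial A := ∑ n ∈ Finset.range (N + 1),
    Polynomial.C (∑ m ∈ Finset.range (n + 1), f m * f (n - m)) * Polynomial.X ^ n
  have hp : ∀ n, n ≤ N → p.coeff n = f n := by
    intro n hn
    simp only [p, Polynomial.finsetSum_coeff, Polynomial.coeff_C_mul_X_pow]
    rw [Finset.sum_ite_eq, if_pos (by simp; omega)]
  have hr : ∀ n, n ≤ N → r.coeff n = ∑ m ∈ Finset.range (n + 1), f m * f (n - m) := by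
    intro n hn
    simp only [r, Polynomial.finsetSum_coeff, Polynomial.coeff_C_mul_X_pow]
    rw [Finset.sum_ite_eq, if_pos (by simp; omega)]
  have : Polynomial.X ^ (N + 1) ∣ p ^ 2 - r := by
    rw [Polynomial.X_pow_dvd_iff]
    intro n hn
    rw [Polynomial.coeff_sub, hr n (by omega), sq, Polynomial.coeff_mul,
      Finset.Nat.sum_antidiagonal_eq_sum_range_succ (fun i j => p.coeff i * p.coeff j) n, sub_eq_zero]
    refine Finset.sum_congr rfl fun m hm => ?_
    simp only [Finset.mem_range] at hm
    rw [hp _ (by omega), hp _ (by omega)]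
  have h2 := map_dvd (Polynomial.evalRingHom t) this
  simpa [p, r, Polynomial.eval_finsetSum] using h2

lemma riccati (q : ℕ → ℕ → ℚ)
    (h : ∀ k, rowPoly q (k + 1) = Polynomial.X * ((4 * Polynomial.X + 1)
        * Polynomial.derivative (rowPoly q k) + 2 * (k : Polynomial ℚ) * rowPoly q k)
      + (4 * Polynomial.X + 1) * rowPoly q k
      + Polynomial.X * ∑ m ∈ Finset.range (k + 1), rowPoly q m * rowPoly q (k - m))
    (h0 : rowPoly q 0 = 1)
    (N : ℕ) (x t g : A) (hx : 2 * D x = (4 * x + 1) * g) (ht : D t = t * g) :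
    t ^ (N + 1) ∣ 2 * t * x * D (val q (Finset.range (N + 1)) x t)
      - (g * (val q (Finset.range (N + 1)) x t - 1)
        - t * g * (4 * x + 1) * val q (Finset.range (N + 1)) x t
        - t * g * x * val q (Finset.range (N + 1)) x t ^ 2) := by
  have h1 := sq_trunc (fun k => Polynomial.aeval x (rowPoly q k)) N t
  set S := ∑ n ∈ Finset.range (N + 1), (∑ m ∈ Finset.range (n + 1),
    Polynomial.aeval x (rowPoly q m) * Polynomial.aeval x (rowPoly q (n - m))) * t ^ n with hS
  set Q := val q (Finset.range (N + 1)) x t with hQ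
  have h2 : 2 * t * x * D Q + t * g * (4 * x + 1) * Q + t * g * x * S
      = g * (Q - 1) + g * Polynomial.aeval x (rowPoly q (N + 1)) * t ^ (N + 1) := by
    have e1 : g * (Q - 1) + g * Polynomial.aeval x (rowPoly q (N + 1)) * t ^ (N + 1)
        = ∑ k ∈ Finset.range (N + 1), g * Polynomial.aeval x (rowPoly q (k + 1)) * t ^ (k + 1) := by
      have e2 := Finset.sum_range_succ (fun k => Polynomial.aeval x (rowPoly q k) * t ^ k) (N + 1)
      rw [Finset.sum_range_succ'] at e2
      simp only [h0, map_one, pow_zero, mul_one] at e2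
      simp only [mul_assoc]
      rw [← Finset.mul_sum, hQ, val]
      linear_combination (-g) * e2
    rw [e1]
    have e3 : 2 * t * x * D Q = t * x * (2 * D Q) := by ring
    rw [e3, hQ, val, hS, map_sum]
    simp only [Finset.mul_sum]
    rw [← Finset.sum_add_distrib, ← Finset.sum_add_distrib]
    refine Finset.sum_congr rfl fun k hk => ?_
    rw [D_term D x t g hx ht, h k]
    simp only [map_add, map_mul, map_sum, map_natCast, map_ofNat, map_one, Polynomial.aeval_X]
    ring
  have e : 2 * t * x * D Q - (g * (Q - 1) - t * g * (4 * x + 1) * Q - t * g * x * Q ^ 2)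
      = t * g * x * (Q ^ 2 - S) + g * Polynomial.aeval x (rowPoly q (N + 1)) * t ^ (N + 1) := by
    linear_combination h2
  rw [e]
  exact dvd_add (dvd_mul_of_dvd_right h1 _) (dvd_mul_left _ _)

/-- truncated logarithm -/
noncomputable def lg (M : ℕ) (u : A) : A :=
  ∑ n ∈ Finset.range M, algebraMap ℚ A ((-1) ^ n / (n + 1)) * u ^ (n + 1)

lemma D_lg (M : ℕ) (u : A) : (1 + u) * D (lg M u) = (1 - (-u) ^ M) * D u := by
  induction M with
  | zero => simp [lg]
  | succ M ih =>
    have : lg (M + 1) u = lg M u + algebraMap ℚ A ((-1) ^ M / (M + 1)) * u ^ (M + 1) :=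
      Finset.sum_range_succ _ _
    rw [this, map_add, mul_add, ih, Derivation.leibniz, Derivation.map_algebraMap,
      Derivation.leibniz_pow]
    simp only [smul_eq_mul, nsmul_eq_mul, Nat.add_sub_cancel]
    have h2 : algebraMap ℚ A ((-1) ^ M / (M + 1)) * ((M + 1 : ℕ) : A) = (-1) ^ M := by
      rw [← map_natCast (algebraMap ℚ A), ← map_mul]
      have : ((-1 : ℚ) ^ M / (M + 1)) * ((M + 1 : ℕ) : ℚ) = (-1) ^ M := by
        push_cast
        field_simp
      rw [this]; simp
    rw [neg_pow u M, neg_pow u (M + 1)]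
    linear_combination ((1 + u) * u ^ M * D u) * h2

lemma lg_dvd (M : ℕ) (t u : A) (h : t ∣ u) : t ∣ lg M u := by
  refine Finset.dvd_sum fun n _ => dvd_mul_of_dvd_right ?_ _
  exact dvd_pow h (by omega)

lemma lg_dvd2 (M : ℕ) (t u : A) (h : t ∣ u) : t ^ 2 ∣ lg (M + 1) u - u := by
  unfold lg
  rw [Finset.sum_range_succ']
  simp only [pow_zero, Nat.cast_zero, zero_add, div_one, map_one, one_mul, pow_one, add_sub_cancel_right]
  refine Finset.dvd_sum fun n _ => dvd_mul_of_dvd_right ?_ _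
  exact (pow_dvd_pow_of_dvd h 2).trans (pow_dvd_pow _ (by omega))

end generic

section algebra

variable {A : Type*} [CommRing A]

/-- Riccati equation for the rescaled second function. -/
lemma alg_conv (t ρ q dq x R : A) (hρ : R * ρ = 1) :
    2 * t * x * (ρ ^ 2 * dq - 2 * ρ ^ 3 * ((R - 1) * (R + 1)) * q)
      - (R ^ 2 * (ρ ^ 2 * q) - 1 - t * R * (4 * x + 1) * (ρ ^ 2 * q)
        - t * x * R * (ρ ^ 2 * q) ^ 2)
    = R * (2 * (t * ρ) * (x * ρ ^ 2) * dq - (ρ * (q - 1)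
        - (t * ρ) * ρ * (4 * (x * ρ ^ 2) + 1) * q - (t * ρ) * ρ * (x * ρ ^ 2) * q ^ 2)) := by
  linear_combination (-2 * t * x * ρ ^ 2 * dq - 1 - R * ρ * q
    - 4 * t * x * q * ρ * (R * ρ + ρ ^ 2)) * hρ

/-- Linear equation for the contiguity defect. -/
lemma alg_F (b t p q dp dq : A) (da a x R α β U V dU dV F : A) (ha : a = b + 1)
    (hR : R = 1 + (a + b) * t) (hda : 2 * da = a + b)
    (hα : α = 1 + a * t) (hβ : β = 1 + b * t) (hx : x = a * b * α * β)
    (hU : U = 1 - b * α * t * p) (hV : V = β + a * α * β * t * q)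
    (hdU : dU = -(da * α * t + b * (da * t + a * (t * R)) * t + b * α * (t * R)) * p
      - b * α * t * dp)
    (hdV : dV = (da * t + b * (t * R)) + (da * α * β * t + a * (da * t + a * (t * R)) * β * t
      + a * α * (da * t + b * (t * R)) * t + a * α * β * (t * R)) * q + a * α * β * t * dq)
    (hF : F = U * V - α) :
    2 * t * x * (dU * V + U * dV - (da * t + a * (t * R)))
      = (2 * t * x * R - α * β * (b * R - a) - t * R * x * p - t * x * R * q) * F
      - b * α * t * V * (2 * t * x * dp - (R * (p - 1) - t * R * (4 * x + 1) * p - t * R * x * p ^ 2))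
      + a * α * β * t * U * (2 * t * x * dq - (R ^ 2 * q - 1 - t * R * (4 * x + 1) * q
        - t * x * R * q ^ 2)) := by
  subst hdU hdV hF hU hV hx hα hβ hR ha
  linear_combination (t * ((b + 1) * b * (1 + (b + 1) * t) * (1 + b * t)) *
    (-((1 + (b + 1) * t) * t + b * t * t) * p * ((1 + b * t) + (b + 1) * (1 + (b + 1) * t) * (1 + b * t) * t * q)
      + (1 - b * (1 + (b + 1) * t) * t * p) * (t + ((1 + (b + 1) * t) * (1 + b * t) * t
        + (b + 1) * t * (1 + b * t) * t + (b + 1) * (1 + (b + 1) * t) * t * t) * q) - t)) * hda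

lemma alg_E (b t p q dp : A) (da a x R α β U V dU F w : A) (ha : a = b + 1)
    (hR : R = 1 + (a + b) * t) (hda : 2 * da = a + b)
    (hα : α = 1 + a * t) (hβ : β = 1 + b * t) (hx : x = a * b * α * β)
    (hw : w = a + b + 2 * a * b * t)
    (hU : U = 1 - b * α * t * p) (hV : V = β + a * α * β * t * q)
    (hdU : dU = -(da * α * t + b * (da * t + a * (t * R)) * t + b * α * (t * R)) * p
      - b * α * t * dp)
    (hF : F = U * V - α) (dY lA lB lU : A) :
    2 * a * α * β * U * (t * dY - t * (a + b) + (w + t) * (lA - lB) - t * lU)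
      = a * α * β * U * t * (2 * dY - R * (q - p))
        + 2 * a * U * β * (w + t) * (α * lA - (da * t + a * (t * R)))
        - 2 * a * U * α * (w + t) * (β * lB - (da * t + b * (t * R)))
        - 2 * a * α * β * t * (U * lU - dU)
        + α * t * (2 * t * x * dp - (R * (p - 1) - t * R * (4 * x + 1) * p - t * R * x * p ^ 2))
        + R * F := by
  subst hdU hF hU hV hx hα hβ hR ha hw
  linear_combination ((b + 1) * (1 - b * (1 + (b + 1) * t) * t * p) * ((b + 1 + b + 2 * (b + 1) * b * t) + t)
      * t * ((1 + b * t) - (1 + (b + 1) * t))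
    + (b + 1) * (1 + (b + 1) * t) * (1 + b * t) * t * ((1 + (b + 1) * t) * t + b * t * t) * p) * hda

end algebra

section concrete

/-- the coefficient-wise Euler derivation -/
noncomputable def dr : Derivation ℚ (PowerSeries (Polynomial ℚ)) (PowerSeries (Polynomial ℚ)) :=
  Derivation.mk'
    { toFun := fun f => PowerSeries.mk fun n =>
        Polynomial.X * Polynomial.derivative (PowerSeries.coeff n f)
      map_add' := by
        intro f g
        ext1 n
        simp [mul_add]
      map_smul' := by
        intro c f
        ext1 n
        simp }
    (by
      intro f g
      ext1 n
      simp only [LinearMap.coe_mk, AddHom.coe_mk, PowerSeries.coeff_mk, smul_eq_mul, map_add,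
        PowerSeries.coeff_mul, Polynomial.derivative_sum, Polynomial.derivative_mul, Finset.mul_sum]
      rw [← Finset.Nat.sum_antidiagonal_swap (n := n) (f := fun x : ℕ × ℕ => PowerSeries.coeff x.1 g *
        (Polynomial.X * Polynomial.derivative (PowerSeries.coeff x.2 f)))]
      rw [← Finset.sum_add_distrib]
      refine Finset.sum_congr rfl fun x _ => ?_
      simp only [Prod.fst_swap, Prod.snd_swap]
      ring)

/-- the parameter `r` -/
noncomputable def rr : PowerSeries (Polynomial ℚ) := PowerSeries.C Polynomial.X

/-- `R = 1 + r t` -/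
noncomputable def RR : PowerSeries (Polynomial ℚ) := 1 + rr * PowerSeries.X

lemma deriv_mul_aux {B : Type*} [CommRing B] (f g : PowerSeries B) :
    PowerSeries.derivative B (f * g)
      = f * PowerSeries.derivative B g + g * PowerSeries.derivative B f :=
  (PowerSeries.derivative B).leibniz f g

/-- the derivation in the power series variable -/
noncomputable def dt : Derivation ℚ (PowerSeries (Polynomial ℚ)) (PowerSeries (Polynomial ℚ)) :=
  Derivation.mk'
    { toFun := fun f => PowerSeries.X * RR * PowerSeries.derivative (Polynomial ℚ) f
      map_add' := by
        intro f g
        rw [map_add, mul_add]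
      map_smul' := by
        intro c f
        have e : PowerSeries.derivative (Polynomial ℚ) (c • f)
            = c • PowerSeries.derivative (Polynomial ℚ) f := by
          ext1 n
          simp [PowerSeries.coeff_derivative]
        rw [e, mul_smul_comm, RingHom.id_apply] }
    (by
      intro f g
      simp only [LinearMap.coe_mk, AddHom.coe_mk]
      have e : PowerSeries.derivative (Polynomial ℚ) (f * g)
          = f * PowerSeries.derivative (Polynomial ℚ) g
            + g * PowerSeries.derivative (Polynomial ℚ) f :=
        deriv_mul_aux f g
      rw [e, smul_eq_mul, smul_eq_mul]
      ring)

/-- the derivation -/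
noncomputable def DD : Derivation ℚ (PowerSeries (Polynomial ℚ)) (PowerSeries (Polynomial ℚ)) :=
  dr + dt

lemma DD_apply (f : PowerSeries (Polynomial ℚ)) :
    DD f = dr f + PowerSeries.X * RR * PowerSeries.derivative (Polynomial ℚ) f := rfl

lemma coeff_dr (f : PowerSeries (Polynomial ℚ)) (n : ℕ) : PowerSeries.coeff n (dr f) =
    Polynomial.X * Polynomial.derivative (PowerSeries.coeff n f) := by
  simp [dr]

lemma DD_C (p : Polynomial ℚ) :
    DD (PowerSeries.C p) = PowerSeries.C (Polynomial.X * Polynomial.derivative p) := by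
  rw [DD_apply, PowerSeries.derivative_C, mul_zero, add_zero]
  ext1 n
  rw [coeff_dr, PowerSeries.coeff_C, PowerSeries.coeff_C]
  split_ifs <;> simp

lemma DD_X : DD PowerSeries.X = PowerSeries.X * RR := by
  rw [DD_apply, PowerSeries.derivative_X, mul_one]
  convert zero_add _
  ext1 n
  rw [coeff_dr, PowerSeries.coeff_X]
  split_ifs <;> simp

lemma coeff_DD (f : PowerSeries (Polynomial ℚ)) (n : ℕ) :
    PowerSeries.coeff (n + 1) (DD f) =
    Polynomial.X * Polynomial.derivative (PowerSeries.coeff (n + 1) f)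
      + ((n : Polynomial ℚ) + 1) * PowerSeries.coeff (n + 1) f + (n : Polynomial ℚ) * Polynomial.X * PowerSeries.coeff n f := by
  have e : DD f = dr f + PowerSeries.X * (PowerSeries.derivative (Polynomial ℚ) f
     + PowerSeries.C Polynomial.X * (PowerSeries.X * PowerSeries.derivative (Polynomial ℚ) f)) := by
    rw [DD_apply, RR, rr]; ring
  rw [e, map_add, coeff_dr, PowerSeries.coeff_succ_X_mul, map_add, PowerSeries.coeff_C_mul,
    PowerSeries.coeff_derivative]
  cases n with
  | zero => simp
  | succ n =>
    rw [PowerSeries.coeff_succ_X_mul, PowerSeries.coeff_derivative]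
    push_cast
    ring

lemma DD_dvd (m : ℕ) (f : PowerSeries (Polynomial ℚ)) (h : PowerSeries.X ^ m ∣ f) :
    PowerSeries.X ^ m ∣ DD f := by
  obtain ⟨g, rfl⟩ := h
  rw [Derivation.leibniz, Derivation.leibniz_pow, DD_X]
  refine dvd_add (by simp) ?_
  cases m with
  | zero => simp
  | succ m =>
    refine ⟨g * ((m + 1 : ℕ) : PowerSeries (Polynomial ℚ)) * RR, ?_⟩
    simp only [smul_eq_mul, nsmul_eq_mul, Nat.add_sub_cancel]
    ring

lemma poly_zero (p : Polynomial ℚ) (m : ℕ)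
    (h : Polynomial.X * Polynomial.derivative p + ((m : Polynomial ℚ) + 1) * p = 0) : p = 0 := by
  ext n
  have h2 := congrArg (fun p => Polynomial.coeff p n) h
  have e : (m + 1 : Polynomial ℚ) * p = Polynomial.C ((m : ℚ) + 1) * p := by simp
  have h3 : (Polynomial.X * Polynomial.derivative p).coeff n = n * p.coeff n := by
    cases n with
    | zero => simp
    | succ n => rw [Polynomial.coeff_X_mul, Polynomial.coeff_derivative]; push_cast; ring
  simp only [e, Polynomial.coeff_add, h3, Polynomial.coeff_C_mul, Polynomial.coeff_zero] at h2
  have h4 : ((n : ℚ) + m + 1) * p.coeff n = 0 := by linear_combination h2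
  rcases mul_eq_zero.1 h4 with h5 | h5
  · exact absurd h5 (by positivity)
  · simpa using h5

/-- uniqueness for the final linear equation -/
lemma final_unique (f : PowerSeries (Polynomial ℚ)) (N : ℕ) (h2 : PowerSeries.X ^ 2 ∣ f)
    (h : PowerSeries.X ^ N ∣ DD f - RR * f) : PowerSeries.X ^ N ∣ f := by
  rw [PowerSeries.X_pow_dvd_iff] at *
  intro m
  induction m with
  | zero => intro _; exact h2 0 (by norm_num)
  | succ m ih =>
    intro hm
    rcases Nat.eq_zero_or_pos m with rfl | hm0
    · exact h2 1 (by norm_num)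
    · obtain ⟨k, rfl⟩ : ∃ k, m = k + 1 := ⟨m - 1, by omega⟩
      have h3 := h _ hm
      have h4 := ih (by omega)
      have e : RR * f = f + PowerSeries.X * (PowerSeries.C Polynomial.X * f) := by
        rw [RR, rr]; ring
      rw [map_sub, coeff_DD, e, map_add, PowerSeries.coeff_succ_X_mul, PowerSeries.coeff_C_mul, h4] at h3
      apply poly_zero _ k
      push_cast at h3
      linear_combination h3

lemma cancel_C (p : Polynomial ℚ) (hp : p ≠ 0) (N : ℕ) (f : PowerSeries (Polynomial ℚ))
    (h : PowerSeries.X ^ N ∣ PowerSeries.C p * f) : PowerSeries.X ^ N ∣ f := by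
  rw [PowerSeries.X_pow_dvd_iff] at *
  intro m hm
  have := h m hm
  rw [PowerSeries.coeff_C_mul] at this
  exact (mul_eq_zero.1 this).resolve_left hp

lemma cancel_unit (u : PowerSeries (Polynomial ℚ)) (hu : PowerSeries.constantCoeff u = 1) (N : ℕ)
    (f : PowerSeries (Polynomial ℚ))
    (h : PowerSeries.X ^ N ∣ u * f) : PowerSeries.X ^ N ∣ f := by
  have : IsUnit u := by
    rw [PowerSeries.isUnit_iff_constantCoeff, hu]; exact isUnit_one
  exact (this.dvd_mul_left).1 h

/-- uniqueness for the linear equation for the contiguity defect -/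
lemma F_unique (N : ℕ) (F h y : PowerSeries (Polynomial ℚ)) (hh : PowerSeries.constantCoeff h = 1)
    (hF : PowerSeries.X ^ N ∣ PowerSeries.X * y * DD F - h * F) : PowerSeries.X ^ N ∣ F := by
  have key : ∀ m, m ≤ N → PowerSeries.X ^ m ∣ F := by
    intro m
    induction m with
    | zero => intro _; simp
    | succ m ih =>
      intro hm
      have h1 := DD_dvd m F (ih (by omega))
      have h2 : PowerSeries.X ^ (m + 1) ∣ PowerSeries.X * y * DD F := by
        obtain ⟨g, hg⟩ := h1
        exact ⟨y * g, by rw [hg]; ring⟩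
      have h3 := (pow_dvd_pow PowerSeries.X hm).trans hF
      have h4 := dvd_sub h2 h3
      rw [sub_sub_cancel] at h4
      exact cancel_unit h hh _ F h4
  exact key N le_rfl

end concrete

section endgame

lemma bern_final (c : ℕ → ℚ)
    (h : ∀ n : ℕ, ∑ k ∈ Finset.range (n + 1), (-1) ^ (k + 1) * ((n + 1).choose k : ℚ) * c (k + 1)
      = -((n : ℚ) + 1) / (2 * (n + 2) * (n + 3))) (k : ℕ) :
    c (k + 1) = bernoulli (k + 2) / (((k : ℚ) + 1) * (k + 2)) := by
  induction k using Nat.strong_induction_on with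
  | _ n ih =>
    have h1 := h n
    -- the Bernoulli numbers satisfy the same relation
    have h2 : ∑ k ∈ Finset.range (n + 1), (-1) ^ (k + 1) * ((n + 1).choose k : ℚ)
        * (bernoulli (k + 2) / (((k : ℚ) + 1) * (k + 2)))
        = -((n : ℚ) + 1) / (2 * (n + 2) * (n + 3)) := by
      have h3 := sum_bernoulli (n + 3)
      rw [Finset.sum_range_succ', Finset.sum_range_succ'] at h3
      simp only [Nat.choose_zero_right, bernoulli_zero, zero_add, Nat.choose_one_right,
        bernoulli_one] at h3
      rw [if_neg (by omega)] at h3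
      have h4 : ∀ k ∈ Finset.range (n + 1), (-1 : ℚ) ^ (k + 1) * ((n + 1).choose k : ℚ)
        * (bernoulli (k + 2) / (((k : ℚ) + 1) * (k + 2)))
        = - (((n + 3).choose (k + 1 + 1) : ℚ) * bernoulli (k + 1 + 1)) / ((n + 2) * (n + 3)) := by
        intro k _
        have e1 : ((n + 3).choose (k + 2) : ℚ) * (k + 2) = (n + 3) * (n + 2).choose (k + 1) := by
          exact_mod_cast (Nat.add_one_mul_choose_eq (n + 2) (k + 1)).symm
        have e2 : ((n + 2).choose (k + 1) : ℚ) * (k + 1) = (n + 2) * (n + 1).choose k := by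
          exact_mod_cast (Nat.add_one_mul_choose_eq (n + 1) k).symm
        have e3 : (-1 : ℚ) ^ (k + 1) * bernoulli (k + 2) = - bernoulli (k + 2) := by
          rcases Nat.even_or_odd k with hk | hk
          · rw [(hk.add_one).neg_one_pow]; ring
          · rw [bernoulli_eq_zero_of_odd (by
              obtain ⟨j, rfl⟩ := hk
              exact ⟨j + 1, by ring⟩) (by omega)]; ring
        have e4 : ((n + 1).choose k : ℚ) / ((k + 1) * (k + 2))
            = (n + 3).choose (k + 2) / ((n + 2) * (n + 3)) := by
          rw [div_eq_div_iff (by positivity) (by positivity)]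
          linear_combination (-((k : ℚ) + 1)) * e1 - ((n : ℚ) + 3) * e2
        calc _ = ((-1 : ℚ) ^ (k + 1) * bernoulli (k + 2)) *
            (((n + 1).choose k : ℚ) / ((k + 1) * (k + 2))) := by ring
          _ = _ := by rw [e3, e4]; ring
      rw [Finset.sum_congr rfl h4, ← Finset.sum_div, Finset.sum_neg_distrib]
      push_cast at h3
      rw [div_eq_div_iff (by positivity) (by positivity)]
      linear_combination (-2 * ((n : ℚ) + 2) * (n + 3)) * h3
    rw [Finset.sum_range_succ] at h1 h2
    rw [Finset.sum_congr rfl (fun k hk => by rw [ih k (Finset.mem_range.1 hk)])] at h1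
    have h5 := h1.trans h2.symm
    have h6 := add_left_cancel h5
    refine mul_left_cancel₀ ?_ h6
    have : ((n + 1).choose n : ℚ) ≠ 0 := by
      exact_mod_cast (Nat.choose_pos (by omega)).ne'
    exact mul_ne_zero (by simp) this

lemma coeff_inv_pow (ρ : PowerSeries ℚ) (hρ : (1 + PowerSeries.X) * ρ = 1) (k m : ℕ) :
    PowerSeries.coeff m (ρ ^ (k + 1)) = (-1) ^ m * ((m + k).choose k : ℚ) := by
  have h0 : ∀ f : PowerSeries ℚ, ∀ m, PowerSeries.coeff (m + 1) (f * ρ)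
      = PowerSeries.coeff (m + 1) f - PowerSeries.coeff m (f * ρ) := by
    intro f m
    have : f * ρ = f - PowerSeries.X * (f * ρ) := by linear_combination f * hρ
    conv_lhs => rw [this]
    rw [map_sub, PowerSeries.coeff_succ_X_mul]
  have h00 : PowerSeries.constantCoeff ρ = 1 := by
    have := congrArg PowerSeries.constantCoeff hρ
    simpa using this
  induction k generalizing m with
  | zero =>
    induction m with
    | zero => simp [h00]
    | succ m ih =>
      have := h0 1 m
      simp only [one_mul] at this
      simp only [zero_add, pow_one] at ih ⊢
      rw [this, ih, PowerSeries.coeff_one]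
      simp; ring
  | succ k ihk =>
    induction m with
    | zero => simp [h00]
    | succ m ih =>
      rw [pow_succ, h0, ← pow_succ, ih, ihk]
      have : (m + 1 + (k + 1)).choose (k + 1) = (m + 1 + k).choose k + (m + (k + 1)).choose (k + 1) := by
        rw [show m + 1 + (k + 1) = (m + 1 + k) + 1 by ring, Nat.choose_succ_succ]
        congr 2; ring
      rw [this]; push_cast; ring

lemma coeff_lg (M n : ℕ) (hn : n < M) :
    PowerSeries.coeff (n + 1) (lg M (PowerSeries.X : PowerSeries ℚ)) = (-1) ^ n / (n + 1) := by
  unfold lg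
  simp only [map_sum, PowerSeries.algebraMap_apply, PowerSeries.coeff_C_mul,
    PowerSeries.coeff_X_pow]
  rw [Finset.sum_eq_single n]
  · simp
  · intro b _ hb
    rw [if_neg (by omega), mul_zero]
  · intro h; simp at h; omega

lemma coeff_final (c : ℕ → ℚ) (n N M : ℕ) (hN : n + 3 ≤ N) (hM : n + 3 ≤ M)
    (ρ : PowerSeries ℚ) (hρ : (1 + PowerSeries.X) * ρ = 1)
    (h : PowerSeries.X ^ (N + 1) ∣ PowerSeries.X * (∑ k ∈ Finset.Icc 1 N,
          PowerSeries.C (c k) * (PowerSeries.X * ρ) ^ k - ∑ k ∈ Finset.Icc 1 N,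
          PowerSeries.C (c k) * PowerSeries.X ^ k - PowerSeries.C (1 / 2) * lg M PowerSeries.X)
        - PowerSeries.X + (1 + PowerSeries.X) * lg M (PowerSeries.X : PowerSeries ℚ)) :
    ∑ k ∈ Finset.range (n + 1), (-1) ^ (k + 1) * ((n + 1).choose k : ℚ) * c (k + 1)
      = -((n : ℚ) + 1) / (2 * (n + 2) * (n + 3)) := by
  rw [PowerSeries.X_pow_dvd_iff] at h
  have h1 := h (n + 2 + 1) (by omega)
  rw [add_mul, one_mul, map_add, map_sub, map_add, PowerSeries.coeff_succ_X_mul,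
    PowerSeries.coeff_succ_X_mul, PowerSeries.coeff_X, if_neg (by omega), map_sub, map_sub,
    PowerSeries.coeff_C_mul, coeff_lg M _ (by omega), coeff_lg M _ (by omega), map_sum, map_sum,
    ← Finset.sum_sub_distrib] at h1
  have h2 : ∀ k, PowerSeries.coeff (n + 2) (PowerSeries.C (c (k + 1)) * (PowerSeries.X * ρ) ^ (k + 1))
      - PowerSeries.coeff (n + 2) (PowerSeries.C (c (k + 1)) * PowerSeries.X ^ (k + 1))
      = if k ≤ n then (-1) ^ n * ((-1) ^ (k + 1) * ((n + 1).choose k : ℚ) * c (k + 1)) else 0 := by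
    intro k
    rw [PowerSeries.coeff_C_mul, PowerSeries.coeff_C_mul, mul_pow, PowerSeries.coeff_X_pow_mul',
      PowerSeries.coeff_X_pow]
    split_ifs with h3 h4 h5 h5 h5 h5
    · omega
    · have : k = n + 1 := by omega
      subst this
      rw [coeff_inv_pow ρ hρ]
      simp
    · rw [coeff_inv_pow ρ hρ]
      obtain ⟨j, rfl⟩ : ∃ j, n = k + j := ⟨n - k, by omega⟩
      rw [show k + j + 2 - (k + 1) = j + 1 by omega, show j + 1 + k = k + j + 1 by ring]
      have : (-1 : ℚ) ^ (k + j) * (-1) ^ (k + 1) = (-1) ^ (j + 1) := by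
        rw [← pow_add, show k + j + (k + 1) = 2 * k + (j + 1) by ring, pow_add, pow_mul]; simp
      rw [← this]; ring
    · omega
    all_goals first | omega | simp
  have h3 : ∑ k ∈ Finset.Icc 1 N, (PowerSeries.coeff (n + 2) (PowerSeries.C (c k) * (PowerSeries.X * ρ) ^ k)
      - PowerSeries.coeff (n + 2) (PowerSeries.C (c k) * PowerSeries.X ^ k))
      = (-1) ^ n * ∑ k ∈ Finset.range (n + 1), (-1) ^ (k + 1) * ((n + 1).choose k : ℚ) * c (k + 1) := by
    rw [show Finset.Icc 1 N = Finset.Ico 1 (N + 1) from rfl, Finset.sum_Ico_eq_sum_range]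
    simp only [add_comm 1, h2, Nat.add_sub_cancel]
    rw [Finset.mul_sum, ← Finset.sum_filter]
    refine Finset.sum_congr ?_ fun _ _ => rfl
    ext k
    simp
    omega
  rw [h3] at h1
  have hs : (-1 : ℚ) ^ n * (-1) ^ n = 1 := by rw [← mul_pow]; simp
  set S := ∑ k ∈ Finset.range (n + 1), (-1) ^ (k + 1) * ((n + 1).choose k : ℚ) * c (k + 1)
  rw [pow_succ, pow_succ] at h1
  push_cast at h1
  have h5 : S = 1 / (2 * ((n : ℚ) + 2)) - 1 / (n + 3) := by
    have e1 : (n : ℚ) + 2 + 1 = n + 3 := by ring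
    have e2 : (n : ℚ) + 1 + 1 = n + 2 := by ring
    rw [e1, e2] at h1
    have e3 : 1 / (2 * ((n : ℚ) + 2)) = 1 / 2 * (1 / (n + 2)) := by field_simp
    rw [e3]
    linear_combination (-1 : ℚ) ^ n * h1 - (S + 1 / (n + 3) - 1 / 2 * (1 / (n + 2))) * hs
  rw [h5]
  field_simp
  ring

end endgame

section main

lemma val_dvd {A : Type*} [CommRing A] [Algebra ℚ A] (c : ℕ → ℕ → ℚ) (N : ℕ) (t x y : A)
    (h : t ∣ y) : t ∣ val c (Finset.Icc 1 N) x y := by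
  refine Finset.dvd_sum fun k hk => dvd_mul_of_dvd_right ?_ _
  exact dvd_pow h (by have := (Finset.mem_Icc.1 hk).1; omega)

open PowerSeries in
lemma main_dvd (q c : ℕ → ℕ → ℚ)
    (hC : ∀ k, 1 ≤ k → rowPoly q k = 2 * (k : Polynomial ℚ) * rowPoly c k
      + (4 * Polynomial.X + 1) * Polynomial.derivative (rowPoly c k))
    (hQ : ∀ k, rowPoly q (k + 1) = Polynomial.X * ((4 * Polynomial.X + 1)
        * Polynomial.derivative (rowPoly q k) + 2 * (k : Polynomial ℚ) * rowPoly q k)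
      + (4 * Polynomial.X + 1) * rowPoly q k
      + Polynomial.X * ∑ m ∈ Finset.range (k + 1), rowPoly q m * rowPoly q (k - m))
    (h0 : rowPoly q 0 = 1) (N : ℕ) :
    ∃ a b ρ p α : PowerSeries (Polynomial ℚ), a = C (Polynomial.C (1 / 2) * (Polynomial.X + 1)) ∧
      b = C (Polynomial.C (1 / 2) * (Polynomial.X - 1)) ∧ RR * ρ = 1 ∧
      (X : PowerSeries (Polynomial ℚ)) ^ (N + 1) ∣
        X * (val c (Finset.Icc 1 N) (a * b * (1 + a * X) * (1 + b * X) * ρ ^ 2) (X * ρ)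
          - val c (Finset.Icc 1 N) (a * b * (1 + a * X) * (1 + b * X)) X
          - C (Polynomial.C (1 / 2)) * lg (N + 1) (rr * X))
        - X * (a + b) + (a + b + 2 * a * b * X + X) * (lg (N + 1) (a * X) - lg (N + 1) (b * X))
        - X * lg (N + 1) (-(b * α * X * p)) := by
  let t : PowerSeries (Polynomial ℚ) := X
  obtain ⟨a, ha⟩ : ∃ a : PowerSeries (Polynomial ℚ),
    a = C (Polynomial.C (1 / 2) * (Polynomial.X + 1)) := ⟨_, rfl⟩
  obtain ⟨b, hb⟩ : ∃ b : PowerSeries (Polynomial ℚ),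
    b = C (Polynomial.C (1 / 2) * (Polynomial.X - 1)) := ⟨_, rfl⟩
  obtain ⟨hf, hhf⟩ : ∃ hf : PowerSeries (Polynomial ℚ), hf = C (Polynomial.C (1 / 2)) := ⟨_, rfl⟩
  have h2hf : 2 * hf = 1 := by
    rw [hhf, ← map_ofNat C 2, ← map_mul, ← map_ofNat Polynomial.C 2, ← map_mul]
    norm_num
  have ha' : a = hf * (rr + 1) := by rw [ha, hhf, rr]; simp
  have hb' : b = hf * (rr - 1) := by rw [hb, hhf, rr]; simp
  have hab : a = b + 1 := by rw [ha', hb']; linear_combination h2hf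
  have hrr : rr = a + b := by rw [ha', hb']; linear_combination (-rr) * h2hf
  obtain ⟨ρ, hρ⟩ : ∃ ρ, RR * ρ = 1 := by
    have : IsUnit RR := by
      rw [PowerSeries.isUnit_iff_constantCoeff]
      simp [RR]
    exact this.exists_right_inv
  have hR : RR = 1 + (a + b) * t := by rw [RR, hrr]
  have hDhf : DD hf = 0 := by rw [hhf, DD_C]; simp
  have hDr : DD rr = rr := by rw [rr, DD_C]; simp
  have hDt : DD t = t * RR := DD_X
  obtain ⟨da, hda'⟩ : ∃ da, DD a = da := ⟨_, rfl⟩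
  have hda : 2 * da = a + b := by
    rw [← hda', ha', hb', Derivation.leibniz, hDhf, map_add, hDr]
    simp
    ring
  have hdb : DD b = da := by
    rw [← hda', hab, map_add]; simp
  have hDR : DD RR = (RR - 1) * (RR + 1) := by
    have : RR = 1 + rr * t := rfl
    conv_lhs => rw [this]
    rw [map_add, Derivation.leibniz, hDr, hDt]
    simp only [Derivation.map_one_eq_zero, smul_eq_mul]
    linear_combination (-(1 + RR)) * this
  have hDρ : DD ρ = - ρ ^ 2 * DD RR := by
    have h1 := congrArg DD hρ
    rw [Derivation.leibniz] at h1
    simp only [Derivation.map_one_eq_zero, smul_eq_mul] at h1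
    linear_combination ρ * h1 - DD ρ * hρ
  obtain ⟨α, hα⟩ : ∃ α, α = 1 + a * t := ⟨_, rfl⟩
  obtain ⟨β, hβ⟩ : ∃ β, β = 1 + b * t := ⟨_, rfl⟩
  obtain ⟨x, hx⟩ : ∃ x, x = a * b * α * β := ⟨_, rfl⟩
  have hDat : DD (a * t) = da * t + a * (t * RR) := by
    rw [Derivation.leibniz, hda', hDt]; simp only [smul_eq_mul]; ring
  have hDbt : DD (b * t) = da * t + b * (t * RR) := by
    rw [Derivation.leibniz, hdb, hDt]; simp only [smul_eq_mul]; ring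
  have hDα : DD α = da * t + a * (t * RR) := by
    rw [hα, map_add, hDat]; simp
  have hDβ : DD β = da * t + b * (t * RR) := by
    rw [hβ, map_add, hDbt]; simp
  have hx1 : 2 * DD x = (4 * x + 1) * RR := by
    rw [hx]
    simp only [Derivation.leibniz, hda', hdb, hDα, hDβ, smul_eq_mul]
    rw [hα, hβ, hR, hab]
    rw [hab] at hda
    linear_combination (b * (1 + (b + 1) * t) * (1 + b * t) + (b + 1) * (1 + (b + 1) * t) * (1 + b * t)
      + (b + 1) * b * t * (1 + b * t) + (b + 1) * b * (1 + (b + 1) * t) * t) * hda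
  have hx2 : 2 * DD (x * ρ ^ 2) = (4 * (x * ρ ^ 2) + 1) * ρ := by
    rw [Derivation.leibniz, Derivation.leibniz_pow, hDρ, hDR]
    simp only [smul_eq_mul, nsmul_eq_mul]
    push_cast
    linear_combination ρ ^ 2 * hx1 + (ρ - 4 * x * ρ ^ 2 * RR) * hρ
  have ht2 : DD (t * ρ) = t * ρ * ρ := by
    rw [Derivation.leibniz, hDρ, hDR, hDt]
    simp only [smul_eq_mul]
    linear_combination (-t * ρ * RR) * hρ
  obtain ⟨p, hp⟩ : ∃ p, p = val q (Finset.range (N + 1)) x t := ⟨_, rfl⟩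
  obtain ⟨q0, hq0⟩ : ∃ q0, q0 = val q (Finset.range (N + 1)) (x * ρ ^ 2) (t * ρ) := ⟨_, rfl⟩
  obtain ⟨q1, hq1⟩ : ∃ q1, q1 = ρ ^ 2 * q0 := ⟨_, rfl⟩
  have E1 := riccati DD q hQ h0 N x t RR hx1 hDt
  have E2 := riccati DD q hQ h0 N (x * ρ ^ 2) (t * ρ) ρ hx2 ht2
  have C1 := D_val DD q c hC h0 N x t RR hx1 hDt
  have C2 := D_val DD q c hC h0 N (x * ρ ^ 2) (t * ρ) ρ hx2 ht2
  rw [← hp] at E1 C1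
  rw [← hq0] at E2 C2
  have hdvd : t ^ (N + 1) ∣ (t * ρ) ^ (N + 1) := by rw [mul_pow]; exact dvd_mul_right _ _
  have E2' := dvd_mul_of_dvd_right (hdvd.trans E2) RR
  rw [← alg_conv t ρ q0 (DD q0) x RR hρ, ← hq1] at E2'
  have hDq1 : DD q1 = ρ ^ 2 * DD q0 - 2 * ρ ^ 3 * ((RR - 1) * (RR + 1)) * q0 := by
    rw [hq1, Derivation.leibniz, Derivation.leibniz_pow, hDρ, hDR]
    simp only [smul_eq_mul, nsmul_eq_mul]
    push_cast
    ring
  rw [← hDq1] at E2'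
  obtain ⟨U, hU⟩ : ∃ U, U = 1 - b * α * t * p := ⟨_, rfl⟩
  obtain ⟨V, hV⟩ : ∃ V, V = β + a * α * β * t * q1 := ⟨_, rfl⟩
  obtain ⟨F, hF⟩ : ∃ F, F = U * V - α := ⟨_, rfl⟩
  have hdU : DD U = -(da * α * t + b * (da * t + a * (t * RR)) * t + b * α * (t * RR)) * p
      - b * α * t * DD p := by
    rw [hU]
    simp only [map_sub, Derivation.leibniz, hdb, hDα, hDt, smul_eq_mul,
      Derivation.map_one_eq_zero]
    ring
  have hdV : DD V = (da * t + b * (t * RR)) + (da * α * β * t + a * (da * t + a * (t * RR)) * β * t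
      + a * α * (da * t + b * (t * RR)) * t + a * α * β * (t * RR)) * q1 + a * α * β * t * DD q1 := by
    rw [hV]
    simp only [map_add, Derivation.leibniz, hda', hDα, hDβ, hDt, smul_eq_mul]
    ring
  have hDF : DD F = DD U * V + U * DD V - (da * t + a * (t * RR)) := by
    rw [hF]
    simp only [map_sub, Derivation.leibniz, hDα, smul_eq_mul]
    ring
  have kF := alg_F b t p q1 (DD p) (DD q1) da a x RR α β U V (DD U) (DD V) F hab hR hda hα hβ hx hU hV
    hdU hdV hF
  rw [← hDF] at kF
  have ct : constantCoeff t = 0 := by simp [t]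
  have cα : constantCoeff α = 1 := by rw [hα]; simp [ct]
  have cβ : constantCoeff β = 1 := by rw [hβ]; simp [ct]
  have cU : constantCoeff U = 1 := by rw [hU]; simp [ct]
  have cR : constantCoeff RR = 1 := by rw [hR]; simp [ct]
  have dF : t ^ (N + 1) ∣ F := by
    refine F_unique (N + 1) F (2 * t * x * RR - α * β * (b * RR - a) - t * RR * x * p - t * x * RR * q1)
      (2 * x) ?_ ?_
    · simp only [map_sub, map_mul, ct, cα, cβ, cR, hab, map_add, map_one]
      ring
    · have e : X * (2 * x) * DD F - (2 * t * x * RR - α * β * (b * RR - a) - t * RR * x * p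
          - t * x * RR * q1) * F = 
          a * α * β * t * U * (2 * t * x * DD q1 - (RR ^ 2 * q1 - 1 - t * RR * (4 * x + 1) * q1
            - t * x * RR * q1 ^ 2))
          - b * α * t * V * (2 * t * x * DD p - (RR * (p - 1) - t * RR * (4 * x + 1) * p
            - t * RR * x * p ^ 2)) := by
        have : X = t := rfl
        rw [this]
        linear_combination kF
      rw [e]
      exact dvd_sub (dvd_mul_of_dvd_right E2' _) (dvd_mul_of_dvd_right E1 _)
  -- the logarithms
  have hlog : ∀ u : PowerSeries (Polynomial ℚ), t ∣ u →
      t ^ (N + 1) ∣ (1 + u) * DD (lg (N + 1) u) - DD u := by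
    intro u hu
    rw [D_lg, show (1 - (-u) ^ (N + 1)) * DD u - DD u = -(-u) ^ (N + 1) * DD u by ring]
    refine dvd_mul_of_dvd_left ?_ _
    rw [dvd_neg]
    exact pow_dvd_pow_of_dvd ((dvd_neg).2 hu) _
  refine ⟨a, b, ρ, p, α, ha, hb, hρ, ?_⟩
  rw [← hhf]
  change t ^ (N + 1) ∣ t * (val c (Finset.Icc 1 N) (a * b * (1 + a * t) * (1 + b * t) * ρ ^ 2) (t * ρ)
          - val c (Finset.Icc 1 N) (a * b * (1 + a * t) * (1 + b * t)) t
          - hf * lg (N + 1) (rr * t))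
        - t * (a + b) + (a + b + 2 * a * b * t + t) * (lg (N + 1) (a * t) - lg (N + 1) (b * t))
        - t * lg (N + 1) (-(b * α * t * p))
  rw [← hα, ← hβ, ← hx]
  obtain ⟨LA, hLA⟩ : ∃ L, L = lg (N + 1) (a * t) := ⟨_, rfl⟩
  obtain ⟨LB, hLB⟩ : ∃ L, L = lg (N + 1) (b * t) := ⟨_, rfl⟩
  obtain ⟨LR, hLR⟩ : ∃ L, L = lg (N + 1) (rr * t) := ⟨_, rfl⟩
  obtain ⟨LU, hLU⟩ : ∃ L, L = lg (N + 1) (-(b * α * t * p)) := ⟨_, rfl⟩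
  have gA := hlog (a * t) (dvd_mul_left _ _)
  have gB := hlog (b * t) (dvd_mul_left _ _)
  have gR := hlog (rr * t) (dvd_mul_left _ _)
  have gU := hlog (-(b * α * t * p)) ((dvd_neg).2 ⟨b * α * p, by ring⟩)
  have eU : 1 + -(b * α * t * p) = U := by rw [hU]; ring
  have eU' : DD (-(b * α * t * p)) = DD U := by rw [← eU, map_add]; simp
  have eR : 1 + rr * t = RR := rfl
  have eR' : DD (rr * t) = DD RR := by rw [← eR, map_add]; simp
  rw [← hLA, ← hα, hDat] at gA
  rw [← hLB, ← hβ, hDbt] at gB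
  rw [← hLR, eR, eR', hDR] at gR
  rw [← hLU, eU, eU'] at gU
  obtain ⟨w, hw⟩ : ∃ w, w = a + b + 2 * a * b * t := ⟨_, rfl⟩
  obtain ⟨Y, hY⟩ : ∃ Y, Y = val c (Finset.Icc 1 N) (x * ρ ^ 2) (t * ρ) - val c (Finset.Icc 1 N) x t
    - hf * LR := ⟨_, rfl⟩
  rw [← hLA, ← hLB, ← hLR, ← hLU, ← hw, ← hY]
  have hDw : DD w = w * RR := by
    rw [hw]
    have : DD (2 * a * b * t) = 2 * (da * b * t + a * da * t + a * b * (t * RR)) := by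
      rw [show 2 * a * b * t = 2 • (a * b * t) by rw [nsmul_eq_mul]; push_cast; ring, map_nsmul]
      simp only [Derivation.leibniz, hda', hdb, hDt, smul_eq_mul, nsmul_eq_mul]
      push_cast
      ring
    rw [map_add, map_add, this, hda', hdb, hR, hab]
    rw [hab] at hda
    linear_combination (1 + b * t + (b + 1) * t) * hda
  have gY : t ^ (N + 1) ∣ 2 * DD Y - RR * (q1 - p) := by
    have e : 2 * DD Y - RR * (q1 - p) = (-ρ) * (RR * DD LR - (RR - 1) * (RR + 1)) := by
      rw [hY, map_sub, map_sub, Derivation.leibniz, hDhf, hq1]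
      simp only [smul_eq_mul]
      linear_combination C2 - C1 - DD LR * h2hf + (DD LR - ρ * q0 - RR) * hρ
    rw [e]
    exact dvd_mul_of_dvd_right gR _
  have kE := alg_E b t p q1 (DD p) da a x RR α β U V (DD U) F w hab hR hda hα hβ hx hw hU hV hdU hF
    (DD Y) (DD LA) (DD LB) (DD LU)
  refine final_unique _ (N + 1) ?_ ?_
  · have v1 := val_dvd c N t x t dvd_rfl
    have v2 := val_dvd c N t (x * ρ ^ 2) (t * ρ) (dvd_mul_right _ _)
    have v3 : t ∣ LR := by rw [hLR]; exact lg_dvd _ _ _ (dvd_mul_left _ _)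
    have v4 : t ∣ LU := by rw [hLU]; exact lg_dvd _ _ _ ((dvd_neg).2 ⟨b * α * p, by ring⟩)
    have v5 : t ^ 2 ∣ LA - a * t := by rw [hLA]; exact lg_dvd2 N _ _ (dvd_mul_left _ _)
    have v6 : t ^ 2 ∣ LB - b * t := by rw [hLB]; exact lg_dvd2 N _ _ (dvd_mul_left _ _)
    have v7 : t ∣ Y := by rw [hY]; exact dvd_sub (dvd_sub v2 v1) (dvd_mul_of_dvd_right v3 _)
    obtain ⟨y4, h4⟩ := v4
    obtain ⟨y5, h5⟩ := v5
    obtain ⟨y6, h6⟩ := v6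
    obtain ⟨y7, h7⟩ := v7
    refine ⟨y7 - y4 + (w + t) * (y5 - y6) + 2 * a * b + 1, ?_⟩
    change _ = t ^ 2 * _
    linear_combination t * h7 - t * h4 + (w + t) * (h5 - h6) + t * hw + (w + t) * t * hab
  · have e : DD (t * Y - t * (a + b) + (w + t) * (LA - LB) - t * LU)
        - RR * (t * Y - t * (a + b) + (w + t) * (LA - LB) - t * LU)
        = t * DD Y - t * (a + b) + (w + t) * (DD LA - DD LB) - t * DD LU := by
      rw [← hrr]
      simp only [map_sub, map_add, Derivation.leibniz, hDt, hDw, hDr, smul_eq_mul]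
      ring
    rw [e]
    obtain ⟨a0, ha0⟩ : ∃ a0 : Polynomial ℚ, a0 = 2 * (Polynomial.C (1 / 2) * (Polynomial.X + 1)) :=
      ⟨_, rfl⟩
    have ha1 : 2 * a = C a0 := by rw [ha0, ha, map_mul C 2, map_ofNat]
    have ha2 : a0 ≠ 0 := by
      intro h
      have := congrArg (Polynomial.eval 1) (ha0.symm.trans h)
      norm_num at this
    apply cancel_C a0 ha2
    apply cancel_unit α cα
    apply cancel_unit β cβ
    apply cancel_unit U cU
    rw [← ha1]
    rw [show U * (β * (α * (2 * a * (t * DD Y - t * (a + b) + (w + t) * (DD LA - DD LB) - t * DD LU))))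
      = 2 * a * α * β * U * (t * DD Y - t * (a + b) + (w + t) * (DD LA - DD LB) - t * DD LU) by ring, kE]
    exact dvd_add (dvd_add (dvd_sub (dvd_sub (dvd_add (dvd_mul_of_dvd_right gY _)
      (dvd_mul_of_dvd_right gA _)) (dvd_mul_of_dvd_right gB _)) (dvd_mul_of_dvd_right gU _))
      (dvd_mul_of_dvd_right E1 _)) (dvd_mul_of_dvd_right dF _)

lemma map_val {A B : Type*} [CommRing A] [Algebra ℚ A] [CommRing B] [Algebra ℚ B] (f : A →+* B)
    (c : ℕ → ℕ → ℚ) (s : Finset ℕ) (x t : A) : f (val c s x t) = val c s (f x) (f t) := by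
  unfold val
  rw [map_sum]
  refine Finset.sum_congr rfl fun k _ => ?_
  rw [map_mul, map_pow, Polynomial.aeval_def, Polynomial.hom_eval₂, Polynomial.aeval_def,
    Subsingleton.elim (f.comp (algebraMap ℚ A)) (algebraMap ℚ B)]

lemma map_lg {A B : Type*} [CommRing A] [Algebra ℚ A] [CommRing B] [Algebra ℚ B] (f : A →+* B)
    (M : ℕ) (x : A) : f (lg M x) = lg M (f x) := by
  unfold lg
  rw [map_sum]
  refine Finset.sum_congr rfl fun k _ => ?_
  rw [map_mul, map_pow, ← RingHom.comp_apply,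
    Subsingleton.elim (f.comp (algebraMap ℚ A)) (algebraMap ℚ B)]

lemma lg_zero {A : Type*} [CommRing A] [Algebra ℚ A] (M : ℕ) : lg M (0 : A) = 0 := by
  simp [lg]

lemma val_zero (c : ℕ → ℕ → ℚ) (hc : ∀ k j, k < j → c k j = 0) (s : Finset ℕ)
    (t : PowerSeries ℚ) :
    val c s 0 t = ∑ k ∈ s, PowerSeries.C (c k 0) * t ^ k := by
  unfold val
  refine Finset.sum_congr rfl fun k _ => ?_
  rw [← coeff_rowPoly c hc k 0, Polynomial.aeval_def, Polynomial.eval₂_at_zero]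
  rfl

end main

end St9

theorem statement9 (q : ℕ → ℕ → ℤ) (hq : IsQ q) (c : ℕ → ℕ → ℚ) (hc : IsC q c) :
    ∀ k : ℕ, 1 ≤ k → c k 0 = bernoulli (k + 1) / ((k : ℚ) * ((k : ℚ) + 1)) := by
  obtain ⟨hq0, hq1, hq2⟩ := hq
  obtain ⟨hc1, hc2⟩ := hc
  let Q : ℕ → ℕ → ℚ := fun k j => (q k j : ℚ)
  have hQ1 : ∀ k j, k < j → Q k j = 0 := fun k j h => by simp [Q, hq1 k j h]
  have hC := St9.rowC Q c hQ1 hc1 hc2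
  have hQ := St9.rowQ Q hQ1 (by
    intro k j hk hj
    have := congrArg (fun z : ℤ => (z : ℚ)) (hq2 k j hk hj)
    simp only [Q]
    rw [this]
    push_cast
    rfl)
  have h0 : St9.rowPoly Q 0 = 1 := by simp [St9.rowPoly, Q, hq0]
  have key : ∀ n : ℕ, ∑ k ∈ Finset.range (n + 1),
      (-1) ^ (k + 1) * ((n + 1).choose k : ℚ) * c (k + 1) 0
      = -((n : ℚ) + 1) / (2 * (n + 2) * (n + 3)) := by
    intro n
    obtain ⟨a, b, ρ, p, α, ha, hb, hρ, h⟩ := St9.main_dvd Q c hC hQ h0 (n + 3)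
    let ψ := PowerSeries.map (Polynomial.evalRingHom (1 : ℚ))
    have ψX : ψ PowerSeries.X = PowerSeries.X := by simp [ψ]
    have ψa : ψ a = 1 := by
      have e : Polynomial.evalRingHom (1 : ℚ) (Polynomial.C (1 / 2) * (Polynomial.X + 1)) = 1 := by
        rw [Polynomial.coe_evalRingHom, Polynomial.eval_mul, Polynomial.eval_C,
          Polynomial.eval_add, Polynomial.eval_X, Polynomial.eval_one]
        norm_num
      rw [ha]
      simp only [ψ, PowerSeries.map_C]
      rw [e, map_one]
    have ψb : ψ b = 0 := by rw [hb]; simp [ψ]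
    have ψr : ψ St9.rr = 1 := by simp [ψ, St9.rr]
    have ψh : ψ (PowerSeries.C (Polynomial.C (1 / 2))) = PowerSeries.C (1 / 2) := by simp [ψ]
    have ψρ : (1 + PowerSeries.X) * ψ ρ = 1 := by
      have := congrArg ψ hρ
      rw [map_mul, St9.RR, map_add, map_mul, ψr, ψX, map_one, one_mul] at this
      exact this
    have h2 := map_dvd ψ h
    simp only [map_pow, map_add, map_sub, map_mul, map_neg, map_one, St9.map_val, St9.map_lg, ψX, ψa,
      ψb, ψr, ψh, zero_mul, mul_zero, one_mul, neg_zero, St9.lg_zero, sub_zero, add_zero,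
      St9.val_zero c hc1, mul_one] at h2
    exact St9.coeff_final (fun k => c k 0) n (n + 3) (n + 3 + 1) le_rfl (by omega) (ψ ρ) ψρ h2
  intro k hk
  obtain ⟨k, rfl⟩ : ∃ j, k = j + 1 := ⟨k - 1, by omega⟩
  rw [St9.bern_final (fun k => c k 0) key k]
  push_cast
  ring_nf
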